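/- Let n ≥ 2 be a natural number. There exists a constant c > 0 depending only on n (and independent of the radii) such that for all real numbers 0 < r1 < r0 and every continuously differentiable function f : ℝⁿ → ℝ satisfying f(x) = 0 for all x with ‖x‖ = r0, one has (∫_{A(r1,r0)} |f(x)|^{n/(n−1)} dx)^{(n−1)/n} ≤ c ∫_{A(r1,r0)} ‖∇f(x)‖ dx. -/

import Mathlib

open MeasureTheory

lemma ann_norm_update {n : ℕ} (x : Fin n → ℝ) (i : Fin n) (t : ℝ) :
    ‖(WithLp.toLp 2 (Function.update x i t) : EuclideanSpace ℝ (Fin n))‖ ^ 2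
      = ‖(WithLp.toLp 2 x : EuclideanSpace ℝ (Fin n))‖ ^ 2 - x i ^ 2 + t ^ 2 := by
  rw [EuclideanSpace.real_norm_sq_eq, EuclideanSpace.real_norm_sq_eq]
  rw [← Finset.add_sum_erase _ _ (Finset.mem_univ i),
    ← Finset.add_sum_erase (f := fun j => (WithLp.toLp 2 x : EuclideanSpace ℝ (Fin n)) j ^ 2)
      _ (Finset.mem_univ i)]
  have : ∑ j ∈ Finset.univ.erase i,
      (WithLp.toLp 2 (Function.update x i t) : EuclideanSpace ℝ (Fin n)) j ^ 2
      = ∑ j ∈ Finset.univ.erase i, (WithLp.toLp 2 x : EuclideanSpace ℝ (Fin n)) j ^ 2 := by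
    apply Finset.sum_congr rfl
    intro j hj
    simp [Function.update_of_ne (Finset.ne_of_mem_erase hj)]
  rw [this]
  simp
  ring

lemma ann_seg {n : ℕ} (A : Set (EuclideanSpace ℝ (Fin n)))
    (f : EuclideanSpace ℝ (Fin n) → ℝ) (hf : ContDiff ℝ 1 f)
    (x : Fin n → ℝ) (i : Fin n) (a b : ℝ) (hab : a ≤ b)
    (h : ∀ t ∈ Set.Ioo a b, WithLp.toLp 2 (Function.update x i t) ∈ A) :
    ‖f (WithLp.toLp 2 (Function.update x i b)) - f (WithLp.toLp 2 (Function.update x i a))‖ₑ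
      ≤ ∫⁻ t, A.indicator (fun y => ‖fderiv ℝ f y‖ₑ) (WithLp.toLp 2 (Function.update x i t)) := by
  have hd : ∀ t, HasDerivAt (fun t => (WithLp.toLp 2 (Function.update x i t) :
      EuclideanSpace ℝ (Fin n))) (WithLp.toLp 2 (Pi.single i 1)) t := fun t =>
    (PiLp.hasFDerivAt_toLp (𝕜 := ℝ) 2 (Function.update x i t)).comp_hasDerivAt t
      (hasDerivAt_update x i t)
  have hc : ContDiff ℝ 1 (fun t => (WithLp.toLp 2 (Function.update x i t) :
      EuclideanSpace ℝ (Fin n))) :=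
    (PiLp.contDiff_toLp (𝕜 := ℝ) (p := 2)).comp (contDiff_update 1 x i)
  refine (enorm_sub_le_lintegral_deriv_of_contDiffOn_Icc
    (f := fun t => f (WithLp.toLp 2 (Function.update x i t)))
    (hf.comp hc).contDiffOn hab).trans ?_
  rw [← restrict_Ioo_eq_restrict_Icc]
  refine (setLIntegral_mono' measurableSet_Ioo (fun t ht => ?_)).trans
    (setLIntegral_le_lintegral (Set.Ioo a b) _)
  rw [Set.indicator_of_mem (h t ht)]
  have h1 := ((hf.differentiable one_ne_zero).differentiableAt.hasFDerivAt
    (x := WithLp.toLp 2 (Function.update x i t))).comp_hasDerivAt t (hd t)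
  have h2 : deriv (fun t => f (WithLp.toLp 2 (Function.update x i t))) t = _ := h1.deriv
  rw [h2]
  refine (ContinuousLinearMap.le_opENorm _ _).trans ?_
  have : ‖(WithLp.toLp 2 (Pi.single i 1) : EuclideanSpace ℝ (Fin n))‖ₑ = 1 := by
    rw [← ofReal_norm_eq_enorm]
    have := EuclideanSpace.norm_single (𝕜 := ℝ) i (1:ℝ)
    simp at this ⊢
  rw [this, mul_one]

lemma ann_point {n : ℕ} {r1 r0 : ℝ} (h1 : 0 < r1)
    (f : EuclideanSpace ℝ (Fin n) → ℝ) (hf : ContDiff ℝ 1 f)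
    (h0 : ∀ x : EuclideanSpace ℝ (Fin n), ‖x‖ = r0 → f x = 0)
    (x : Fin n → ℝ) (i : Fin n)
    (hx : r1 < ‖(WithLp.toLp 2 x : EuclideanSpace ℝ (Fin n))‖ ∧
      ‖(WithLp.toLp 2 x : EuclideanSpace ℝ (Fin n))‖ < r0) :
    ‖f (WithLp.toLp 2 x)‖ₑ
      ≤ ∫⁻ t, {x : EuclideanSpace ℝ (Fin n) | r1 < ‖x‖ ∧ ‖x‖ < r0}.indicator
          (fun y => ‖fderiv ℝ f y‖ₑ) (WithLp.toLp 2 (Function.update x i t)) := by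
  obtain ⟨hx1, hx2⟩ := hx
  set N := ‖(WithLp.toLp 2 x : EuclideanSpace ℝ (Fin n))‖ with hN
  have hr0 : 0 < r0 := by linarith
  set T := √(r0 ^ 2 - N ^ 2 + x i ^ 2) with hT
  have hpos : x i ^ 2 < r0 ^ 2 - N ^ 2 + x i ^ 2 := by nlinarith
  have hTsq : T ^ 2 = r0 ^ 2 - N ^ 2 + x i ^ 2 := Real.sq_sqrt (by nlinarith [sq_nonneg (x i)])
  have hT0 : 0 ≤ T := Real.sqrt_nonneg _
  have habs : |x i| < T := abs_lt_of_sq_lt_sq (by rw [hTsq]; exact hpos) hT0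
  have hmem : ∀ t : ℝ, |x i| < |t| → |t| < T →
      WithLp.toLp 2 (Function.update x i t) ∈
        {x : EuclideanSpace ℝ (Fin n) | r1 < ‖x‖ ∧ ‖x‖ < r0} := by
    intro t ht1 ht2
    have e := ann_norm_update x i t
    have s1 : x i ^ 2 < t ^ 2 := sq_lt_sq.2 ht1
    have s2 : t ^ 2 < T ^ 2 := sq_lt_sq.2 (by rwa [abs_of_nonneg hT0])
    constructor
    · apply lt_of_pow_lt_pow_left₀ 2 (norm_nonneg _)
      rw [e]; nlinarith
    · apply lt_of_pow_lt_pow_left₀ 2 hr0.le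
      rw [e]; linarith
  have hend : ∀ t : ℝ, t ^ 2 = T ^ 2 → f (WithLp.toLp 2 (Function.update x i t)) = 0 := by
    intro t ht
    apply h0
    have e := ann_norm_update x i t
    rw [ht, hTsq] at e
    exact (pow_left_inj₀ (norm_nonneg _) hr0.le two_ne_zero).1 (by rw [e]; ring)
  rcases le_total 0 (x i) with hs | hs
  · rw [abs_of_nonneg hs] at habs hmem
    have := ann_seg _ f hf x i (x i) T habs.le (fun t ht => hmem t
      (by rw [abs_of_nonneg (by linarith [ht.1])]; exact ht.1)
      (by rw [abs_of_nonneg (by linarith [ht.1])]; exact ht.2))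
    rw [hend T rfl, Function.update_eq_self, zero_sub, enorm_neg] at this
    exact this
  · rw [abs_of_nonpos hs] at habs hmem
    have := ann_seg _ f hf x i (-T) (x i) (by linarith) (fun t ht => hmem t
      (by rw [abs_of_nonpos (by linarith [ht.2])]; linarith [ht.2])
      (by rw [abs_of_nonpos (by linarith [ht.2])]; linarith [ht.1]))
    rw [hend (-T) (by ring), Function.update_eq_self, sub_zero] at this
    exact this

lemma ann_lintegral {n : ℕ} (hn : 2 ≤ n) {r1 r0 : ℝ} (h1 : 0 < r1)
    (f : EuclideanSpace ℝ (Fin n) → ℝ) (hf : ContDiff ℝ 1 f)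
    (h0 : ∀ x : EuclideanSpace ℝ (Fin n), ‖x‖ = r0 → f x = 0) :
    ∫⁻ x in {x : EuclideanSpace ℝ (Fin n) | r1 < ‖x‖ ∧ ‖x‖ < r0},
        ‖f x‖ₑ ^ ((n : ℝ) / ((n : ℝ) - 1))
      ≤ (∫⁻ x in {x : EuclideanSpace ℝ (Fin n) | r1 < ‖x‖ ∧ ‖x‖ < r0},
        ‖fderiv ℝ f x‖ₑ) ^ ((n : ℝ) / ((n : ℝ) - 1)) := by
  have hn' : (2:ℝ) ≤ n := by exact_mod_cast hn
  set A := {x : EuclideanSpace ℝ (Fin n) | r1 < ‖x‖ ∧ ‖x‖ < r0} with hA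
  have hAm : MeasurableSet A :=
    (measurableSet_lt measurable_const measurable_norm).inter
      (measurableSet_lt measurable_norm measurable_const)
  have hg : Measurable (A.indicator (fun y => ‖fderiv ℝ f y‖ₑ)) :=
    ((hf.continuous_fderiv one_ne_zero).enorm.measurable).indicator hAm
  have hmp := PiLp.volume_preserving_toLp (Fin n)
  have hp : Real.HolderConjugate (Fintype.card (Fin n)) ((n : ℝ) / ((n : ℝ) - 1)) := by
    rw [Fintype.card_fin]
    exact Real.HolderConjugate.conjExponent (by linarith)
  rw [← lintegral_indicator hAm, ← lintegral_indicator hAm,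
    ← hmp.lintegral_comp_emb (MeasurableEquiv.toLp 2 (Fin n → ℝ)).measurableEmbedding,
    ← hmp.lintegral_comp_emb (MeasurableEquiv.toLp 2 (Fin n → ℝ)).measurableEmbedding]
  refine le_trans ?_ (lintegral_prod_lintegral_pow_le (fun _ : Fin n => (volume : Measure ℝ)) hp
    (hg.comp hmp.measurable))
  refine lintegral_mono fun x => ?_
  by_cases hx : WithLp.toLp 2 x ∈ A
  · rw [Set.indicator_of_mem hx]
    calc ‖f (WithLp.toLp 2 x)‖ₑ ^ ((n : ℝ) / ((n : ℝ) - 1))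
        = (‖f (WithLp.toLp 2 x)‖ₑ ^ (1 / ((n : ℝ) - 1))) ^ (n : ℝ) := by
          rw [← ENNReal.rpow_mul]; congr 1; ring
      _ = ∏ _i : Fin n, ‖f (WithLp.toLp 2 x)‖ₑ ^ (1 / ((n : ℝ) - 1)) := by
          rw [Finset.prod_const]; simp
      _ ≤ _ := by
          refine Finset.prod_le_prod' fun i _ => ?_
          rw [Fintype.card_fin]
          refine ENNReal.rpow_le_rpow (ann_point h1 f hf h0 x i hx) ?_
          exact div_nonneg zero_le_one (by linarith)
  · rw [Set.indicator_of_notMem hx]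
    exact zero_le

/-- L¹ Sobolev inequality on a Euclidean annulus for functions vanishing on the outer
boundary, with constant independent of the radii (proof of Lemma 4.1(2) of the paper). -/
theorem annulus_sobolev_L1 (n : ℕ) (hn : 2 ≤ n) :
    ∃ c : ℝ, 0 < c ∧ ∀ r1 r0 : ℝ, 0 < r1 → r1 < r0 →
      ∀ f : EuclideanSpace ℝ (Fin n) → ℝ, ContDiff ℝ 1 f →
      (∀ x : EuclideanSpace ℝ (Fin n), ‖x‖ = r0 → f x = 0) →
      (∫ x in {x : EuclideanSpace ℝ (Fin n) | r1 < ‖x‖ ∧ ‖x‖ < r0},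
          |f x| ^ ((n : ℝ) / ((n : ℝ) - 1))) ^ (((n : ℝ) - 1) / (n : ℝ))
        ≤ c * ∫ x in {x : EuclideanSpace ℝ (Fin n) | r1 < ‖x‖ ∧ ‖x‖ < r0},
            ‖fderiv ℝ f x‖ := by
  refine ⟨1, one_pos, fun r1 r0 h1 h10 f hf h0 => ?_⟩
  have hn' : (2:ℝ) ≤ n := by exact_mod_cast hn
  have key := ann_lintegral hn h1 f hf h0
  set A := {x : EuclideanSpace ℝ (Fin n) | r1 < ‖x‖ ∧ ‖x‖ < r0} with hA
  have hp0 : 0 ≤ (n : ℝ) / ((n : ℝ) - 1) := div_nonneg (by linarith) (by linarith)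
  have hcd := hf.continuous_fderiv one_ne_zero
  have hfin : ∫⁻ x in A, ‖fderiv ℝ f x‖ₑ ≠ ⊤ := by
    have : IntegrableOn (fderiv ℝ f) A :=
      (hcd.continuousOn.integrableOn_compact (isCompact_closedBall 0 r0)).mono_set
        (fun x hx => by simpa using hx.2.le)
    exact this.2.ne
  rw [one_mul, integral_norm_eq_lintegral_enorm hcd.aestronglyMeasurable]
  have e : ∫ x in A, |f x| ^ ((n : ℝ) / ((n : ℝ) - 1))
      = (∫⁻ x in A, ‖f x‖ₑ ^ ((n : ℝ) / ((n : ℝ) - 1))).toReal := by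
    rw [integral_eq_lintegral_of_nonneg_ae
      (Filter.Eventually.of_forall fun x => Real.rpow_nonneg (abs_nonneg _) _)
      ((hf.continuous.abs.rpow_const fun x => Or.inr hp0).aestronglyMeasurable)]
    congr 1
    refine lintegral_congr fun x => ?_
    rw [← ENNReal.ofReal_rpow_of_nonneg (abs_nonneg _) hp0, ← Real.norm_eq_abs,
      ofReal_norm_eq_enorm]
  rw [e, ENNReal.toReal_rpow]
  refine ENNReal.toReal_mono hfin ?_
  refine (ENNReal.rpow_le_rpow key (div_nonneg (by linarith) (by linarith))).trans ?_
  rw [← ENNReal.rpow_mul, div_mul_div_cancel₀ (by linarith), div_self (by linarith),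
    ENNReal.rpow_one]
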